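/- Let n ≥ 1, s ≥ 1, and s₁, s₂ > 0 with 1 ≤ s₁ < n/2 + 1 and s₁ + s₂ = s + n/2 + 1. There exists a constant c > 0 (depending only on n, s, s₁, s₂ and φ) such that for all Schwartz vector fields u, B : ℝⁿ → ℝⁿ, Σ_{j∈ℤ} ‖Λ^s[((Ṡ_{j−9}u)·∇)Δ_j B] − ((Ṡ_{j−9}u)·∇)(Λ^s Δ_j B)‖²_{L²} ≤ c·‖u‖²_{Ḣ^{s₁}}·‖B‖²_{Ḣ^{s₂}}. -/

import Mathlib

open MeasureTheory Filter SchwartzMap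
open scoped FourierTransform

noncomputable section

abbrev Ell (n : ℕ) := EuclideanSpace ℝ (Fin n)

def eVec (n : ℕ) (i : Fin n) : Ell n := EuclideanSpace.single i 1

/-- coercion of a real-valued function to a complex-valued one -/
def cf {n : ℕ} (f : Ell n → ℝ) : Ell n → ℂ := fun x => (f x : ℂ)

/-- the Fourier multiplier operator `Λ^s` with symbol `|ξ|^s` -/
def Lam {n : ℕ} (s : ℝ) (f : Ell n → ℂ) : Ell n → ℂ :=
  𝓕⁻ (fun ξ => ((‖ξ‖ ^ s : ℝ) : ℂ) * 𝓕 f ξ)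

/-- the partial derivative `∂ᵢ` -/
def pd {n : ℕ} (i : Fin n) (f : Ell n → ℂ) : Ell n → ℂ :=
  fun x => fderiv ℝ f x (eVec n i)

/-- the advection term `(v·∇)w` for complex vector fields -/
def adv {n : ℕ} (v w : Fin n → Ell n → ℂ) : Fin n → Ell n → ℂ :=
  fun l x => ∑ i, v i x * pd i (w l) x

/-- squared homogeneous Sobolev norm of a complex scalar function -/
def HsqC {n : ℕ} (s : ℝ) (f : Ell n → ℂ) : ℝ :=
  ∫ ξ, ‖ξ‖ ^ (2 * s) * ‖𝓕 f ξ‖ ^ 2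

/-- homogeneous Sobolev norm `‖u‖_{Ḣ^s}` of a real vector field -/
def Hnorm {n : ℕ} (s : ℝ) (u : Fin n → Ell n → ℝ) : ℝ :=
  Real.sqrt (∑ l, HsqC s (cf (u l)))

/-- `L²` norm of a complex vector field -/
def vL2 {n : ℕ} (f : Fin n → Ell n → ℂ) : ℝ :=
  Real.sqrt (∑ l, ∫ x, ‖f l x‖ ^ 2)

/-- `L²` pairing `⟨f,g⟩ = Σ_l ∫ f_l g_l` of complex vector fields -/
def Cinner {n : ℕ} (f g : Fin n → Ell n → ℂ) : ℂ :=
  ∑ l, ∫ x, f l x * g l x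

/-- The standing assumptions on the Littlewood–Paley function `φ`: a smooth,
radial, compactly supported function with values in `[0,1]`, supported in the
annulus `{3/4 ≤ |ξ| ≤ 8/3}`, with `Σ_{j∈ℤ} φ(2^{−j}ξ) = 1` for `ξ ≠ 0` and
`φ(2^{−j}·), φ(2^{−j'}·)` having disjoint supports when `|j−j'| ≥ 2`. -/
def LPFunction {n : ℕ} (φ : Ell n → ℝ) : Prop :=
  ContDiff ℝ (⊤ : ℕ∞) φ ∧ HasCompactSupport φ ∧
  (∀ ξ, φ ξ ≠ 0 → 3 / 4 ≤ ‖ξ‖ ∧ ‖ξ‖ ≤ 8 / 3) ∧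
  (∀ ξ, φ ξ ∈ Set.Icc (0 : ℝ) 1) ∧
  (∀ ξ η : Ell n, ‖ξ‖ = ‖η‖ → φ ξ = φ η) ∧
  (∀ ξ : Ell n, ξ ≠ 0 → (∑' j : ℤ, φ ((2 : ℝ) ^ (-j) • ξ)) = 1) ∧
  (∀ j j' : ℤ, 2 ≤ |j - j'| → ∀ ξ : Ell n,
    φ ((2 : ℝ) ^ (-j) • ξ) * φ ((2 : ℝ) ^ (-j') • ξ) = 0)

/-- the homogeneous dyadic block `Δ_j u = 𝓕⁻¹(φ(2^{−j}ξ) û(ξ))` -/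
def DeltaJ {n : ℕ} (φ : Ell n → ℝ) (j : ℤ) (f : Ell n → ℂ) : Ell n → ℂ :=
  𝓕⁻ (fun ξ => ((φ ((2 : ℝ) ^ (-j) • ξ) : ℝ) : ℂ) * 𝓕 f ξ)

/-- the homogeneous cutoff `Ṡ_j u = Σ_{j' ≤ j−1} Δ_{j'} u` -/
def SJ {n : ℕ} (φ : Ell n → ℝ) (j : ℤ) (f : Ell n → ℂ) : Ell n → ℂ :=
  fun x => ∑' j' : ℤ, if j' ≤ j - 1 then DeltaJ φ j' f x else 0

/-- `L²` norm of `Δ_j u` for a real vector field `u` -/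
def DeltaL2 {n : ℕ} (φ : Ell n → ℝ) (j : ℤ) (u : Fin n → Ell n → ℝ) : ℝ :=
  Real.sqrt (∑ l, ∫ x, ‖DeltaJ φ j (cf (u l)) x‖ ^ 2)

/-- the homogeneous Besov norm `‖u‖_{Ḃ^s_{2,1}} = Σ_{j∈ℤ} 2^{js} ‖Δ_j u‖_{L²}` -/
def Bnorm {n : ℕ} (φ : Ell n → ℝ) (s : ℝ) (u : Fin n → Ell n → ℝ) : ℝ :=
  ∑' j : ℤ, (2 : ℝ) ^ ((j : ℝ) * s) * DeltaL2 φ j u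

section FourierLemmas

variable {n : ℕ}

/-- The Fourier transform of an integrable square-integrable function agrees almost everywhere
with its `L²` Fourier transform. -/
lemma fourier_ae_eq_fourier_toLp {f : Ell n → ℂ} (h1 : Integrable f) (h2 : MemLp f 2) :
    ∀ᵐ x, 𝓕 f x = (𝓕 (h2.toLp f) : Lp ℂ 2 (volume : Measure (Ell n))) x := by
  have hcont : Continuous (𝓕 f) :=
    VectorFourier.fourierIntegral_continuous Real.continuous_fourierChar continuous_inner h1
  refine ae_eq_of_integral_contDiff_smul_eq hcont.locallyIntegrable
    ((Lp.memLp _).locallyIntegrable (by norm_num)) fun g hg hgc => ?_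
  have hg₁ : HasCompactSupport (Complex.ofRealCLM ∘ g) := hgc.comp_left rfl
  have hg₂ : ContDiff ℝ (⊤ : ℕ∞) (Complex.ofRealCLM ∘ g) := by fun_prop
  set G := hg₁.toSchwartzMap hg₂ with hG
  have key := congrArg (fun T => T G) (Lp.fourier_toTemperedDistribution_eq (h2.toLp f))
  simp only [TemperedDistribution.fourier_apply, Lp.toTemperedDistribution_apply] at key
  have hflip : ∫ ξ, 𝓕 G ξ • f ξ = ∫ x, G x • 𝓕 f x := by
    simpa using! VectorFourier.integral_fourierIntegral_smul_eq_flip (L := innerₗ (Ell n))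
      Real.continuous_fourierChar continuous_inner G.integrable h1
  calc ∫ x, g x • 𝓕 f x = ∫ x, G x • 𝓕 f x := by simp [hG]
    _ = ∫ ξ, 𝓕 G ξ • f ξ := hflip.symm
    _ = ∫ ξ, 𝓕 G ξ • (h2.toLp f) ξ := by
        refine integral_congr_ae ?_
        filter_upwards [h2.coeFn_toLp] with x hx
        rw [hx]
    _ = _ := by rw [key]; simp [hG]

/-- Plancherel's identity for the inverse Fourier integral of a function in `L¹ ∩ L²`. -/
lemma integral_norm_sq_fourierInv {f : Ell n → ℂ} (h1 : Integrable f) (h2 : MemLp f 2) :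
    ∫ x, ‖𝓕⁻ f x‖ ^ 2 = ∫ x, ‖f x‖ ^ 2 := by
  have hL (F : Lp ℂ 2 (volume : Measure (Ell n))) : ∫ x, ‖F x‖ ^ 2 = ‖F‖ ^ 2 := by
    have h := L2.inner_def (𝕜 := ℂ) F F
    rw [inner_self_eq_norm_sq_to_K] at h
    have : ∀ x, inner ℂ (F x) (F x) = ((‖F x‖ ^ 2 : ℝ) : ℂ) := fun x => by
      rw [inner_self_eq_norm_sq_to_K]; norm_cast
    simp_rw [this] at h
    rw [integral_complex_ofReal] at h
    refine Complex.ofReal_injective (h.symm.trans ?_)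
    norm_cast
  calc ∫ x, ‖𝓕⁻ f x‖ ^ 2 = ∫ x, ‖𝓕 f (-x)‖ ^ 2 := by
        simp_rw [Real.fourierInv_eq_fourier_neg]
    _ = ∫ x, ‖𝓕 f x‖ ^ 2 := integral_neg_eq_self (fun x => ‖𝓕 f x‖ ^ 2) _
    _ = ∫ x, ‖(𝓕 (h2.toLp f) : Lp ℂ 2 (volume : Measure (Ell n))) x‖ ^ 2 := by
        refine integral_congr_ae ?_
        filter_upwards [fourier_ae_eq_fourier_toLp h1 h2] with x hx
        rw [hx]
    _ = ∫ x, ‖h2.toLp f x‖ ^ 2 := by rw [hL, hL, Lp.norm_fourier_eq]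
    _ = ∫ x, ‖f x‖ ^ 2 := by
        refine integral_congr_ae ?_
        filter_upwards [h2.coeFn_toLp] with x hx
        rw [hx]

/-- The inverse Fourier transform turns convolutions into products. -/
lemma fourierInv_convolution {a b : Ell n → ℂ} (ha : Integrable a) (hb : Integrable b)
    (x : Ell n) :
    𝓕⁻ (convolution a b (ContinuousLinearMap.mul ℂ ℂ) volume) x = 𝓕⁻ a x * 𝓕⁻ b x := by
  simp only [Real.fourierInv_eq_fourier_neg]
  exact Real.fourier_mul_convolution_eq ha hb (-x)

lemma continuous_fourierInv {a : Ell n → ℂ} (ha : Integrable a) : Continuous (𝓕⁻ a) := by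
  have h : Continuous (𝓕 a) :=
    VectorFourier.fourierIntegral_continuous Real.continuous_fourierChar continuous_inner ha
  have : 𝓕⁻ a = fun x => 𝓕 a (-x) := funext fun x => Real.fourierInv_eq_fourier_neg a x
  rw [this]
  exact h.comp continuous_neg

lemma norm_fourierInv_le (a : Ell n → ℂ) (x : Ell n) : ‖𝓕⁻ a x‖ ≤ ∫ t, ‖a t‖ := by
  rw [Real.fourierInv_eq_fourier_neg]
  exact VectorFourier.norm_fourierIntegral_le_integral_norm _ _ _ _ _

lemma integrable_fourierInv_mul {a : Ell n → ℂ} (ha : Integrable a) (b : 𝓢(Ell n, ℂ)) :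
    Integrable (fun x => 𝓕⁻ a x * 𝓕⁻ (b : Ell n → ℂ) x) := by
  have hb : Integrable (𝓕⁻ (b : Ell n → ℂ)) := by
    rw [← SchwartzMap.fourierInv_coe]; exact (𝓕⁻ b).integrable
  exact hb.bdd_mul (continuous_fourierInv ha).aestronglyMeasurable
    (ae_of_all _ (norm_fourierInv_le a))

/-- The Fourier transform of the product of two inverse Fourier transforms. -/
lemma fourier_fourierInv_mul {a : Ell n → ℂ} (ha : Integrable a) (b : 𝓢(Ell n, ℂ)) :
    𝓕 (fun x => 𝓕⁻ a x * 𝓕⁻ (b : Ell n → ℂ) x)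
      = convolution a b (ContinuousLinearMap.mul ℂ ℂ) volume := by
  have heq : (fun x => 𝓕⁻ a x * 𝓕⁻ (b : Ell n → ℂ) x)
      = 𝓕⁻ (convolution a b (ContinuousLinearMap.mul ℂ ℂ) volume) :=
    funext fun x => (fourierInv_convolution ha b.integrable x).symm
  have hbdd : BddAbove (Set.range fun x => ‖b x‖) :=
    ⟨SchwartzMap.seminorm ℝ 0 0 b, by rintro _ ⟨x, rfl⟩; exact b.norm_le_seminorm ℝ x⟩
  have h_int := integrable_fourierInv_mul ha b
  rw [heq] at h_int ⊢
  refine Continuous.fourier_fourierInv_eq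
    (hbdd.continuous_convolution_right_of_integrable _ ha b.continuous)
    (ha.integrable_convolution _ b.integrable) ?_
  have h := h_int.comp_neg
  convert h using 1
  ext x
  rw [Real.fourierInv_eq_fourier_neg, neg_neg]

/-- Differentiation of an inverse Fourier transform. -/
lemma pd_fourierInv {g : Ell n → ℂ} (hg : Integrable g)
    (hg' : Integrable (fun ξ => ‖ξ‖ * ‖g ξ‖)) (i : Fin n) :
    pd i (𝓕⁻ g) = 𝓕⁻ (fun ξ => (2 * Real.pi * Complex.I * (ξ i : ℂ)) * g ξ) := by
  ext x
  rw [Real.fourierInv_eq_fourier_comp_neg, Real.fourierInv_eq_fourier_comp_neg, pd]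
  have hn1 : Integrable (fun ξ => g (-ξ)) := hg.comp_neg
  have hn2 : Integrable (fun ξ => ‖ξ‖ * ‖g (-ξ)‖) := by simpa using hg'.comp_neg
  rw [Real.fderiv_fourier hn1 hn2, Real.fourier_continuousLinearMap_apply]
  · refine congrArg (fun h : Ell n → ℂ => 𝓕 h x) (funext fun ξ => ?_)
    have hin : innerSL ℝ ξ (EuclideanSpace.single i (1 : ℝ)) = ξ i := by
      rw [innerSL_apply_apply, EuclideanSpace.inner_single_right]; simp
    simp [eVec, hin]
    ring
  · refine (hn2.const_mul (2 * Real.pi * ‖innerSL ℝ (E := Ell n)‖)).mono'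
      hn1.aestronglyMeasurable.fourierSMulRight (ae_of_all _ fun v => ?_)
    refine (VectorFourier.norm_fourierSMulRight_le _ _ _).trans (le_of_eq (by ring))

end FourierLemmas

section Inequalities

open scoped ENNReal

/-- The Cauchy–Schwarz inequality for `ℝ≥0∞`-valued functions. -/
lemma sq_lintegral_mul_le {α : Type*} [MeasurableSpace α] {μ : Measure α} {f g : α → ℝ≥0∞}
    (hf : AEMeasurable f μ) (hg : AEMeasurable g μ) :
    (∫⁻ x, f x * g x ∂μ) ^ 2 ≤ (∫⁻ x, f x ^ 2 ∂μ) * ∫⁻ x, g x ^ 2 ∂μ := by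
  have h := ENNReal.lintegral_mul_le_Lp_mul_Lq μ Real.HolderConjugate.two_two hf hg
  simp only [Pi.mul_apply, ENNReal.rpow_ofNat] at h
  calc (∫⁻ x, f x * g x ∂μ) ^ 2
      ≤ ((∫⁻ x, f x ^ 2 ∂μ) ^ (1 / 2 : ℝ) * (∫⁻ x, g x ^ 2 ∂μ) ^ (1 / 2 : ℝ)) ^ 2 := by
        gcongr
    _ = _ := by
        rw [mul_pow, ← ENNReal.rpow_natCast, ← ENNReal.rpow_natCast, ← ENNReal.rpow_mul,
          ← ENNReal.rpow_mul]
        norm_num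

/-- Young's convolution inequality `L¹ * L² ⊆ L²`. -/
lemma lintegral_sq_conv_le {n : ℕ} {H G : Ell n → ℝ≥0∞} (hH : AEMeasurable H) (hG : Measurable G) :
    ∫⁻ ξ, (∫⁻ t, H t * G (ξ - t)) ^ 2 ≤ (∫⁻ t, H t) ^ 2 * ∫⁻ ξ, G ξ ^ 2 := by
  have hpt (ξ : Ell n) :
      (∫⁻ t, H t * G (ξ - t)) ^ 2 ≤ (∫⁻ t, H t) * ∫⁻ t, H t * G (ξ - t) ^ 2 := by
    have hsq (t : Ell n) : (H t ^ (1 / 2 : ℝ)) ^ 2 = H t := by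
      rw [← ENNReal.rpow_natCast, ← ENNReal.rpow_mul]; norm_num
    have hGm : AEMeasurable fun t => G (ξ - t) :=
      (hG.comp (measurable_const.sub measurable_id)).aemeasurable
    have h := sq_lintegral_mul_le (μ := volume) (f := fun t => H t ^ (1 / 2 : ℝ))
      (g := fun t => H t ^ (1 / 2 : ℝ) * G (ξ - t)) (hH.pow_const _) ((hH.pow_const _).mul hGm)
    simpa only [mul_pow, hsq, ← mul_assoc, ← sq] using h
  calc ∫⁻ ξ, (∫⁻ t, H t * G (ξ - t)) ^ 2
      ≤ ∫⁻ ξ, (∫⁻ t, H t) * ∫⁻ t, H t * G (ξ - t) ^ 2 := lintegral_mono hpt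
    _ = (∫⁻ t, H t) * ∫⁻ ξ, ∫⁻ t, H t * G (ξ - t) ^ 2 := by
        refine lintegral_const_mul'' _ (AEMeasurable.lintegral_prod_right'
          (f := fun p : Ell n × Ell n => H p.2 * G (p.1 - p.2) ^ 2) ?_)
        exact hH.comp_snd.mul
          ((hG.comp (measurable_fst.sub measurable_snd)).pow_const 2).aemeasurable
    _ = (∫⁻ t, H t) * ∫⁻ t, ∫⁻ ξ, H t * G (ξ - t) ^ 2 := by
        rw [lintegral_lintegral_swap]
        exact hH.comp_snd.mul
          ((hG.comp (measurable_fst.sub measurable_snd)).pow_const 2).aemeasurable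
    _ = (∫⁻ t, H t) * ∫⁻ t, H t * ∫⁻ ξ, G ξ ^ 2 := by
        congr 1
        refine lintegral_congr fun t => ?_
        have hGm : Measurable fun ξ => G (ξ - t) ^ 2 :=
          (hG.comp (measurable_id.sub measurable_const)).pow_const 2
        rw [lintegral_const_mul _ hGm, lintegral_sub_right_eq_self (fun ξ => G ξ ^ 2) t]
    _ = _ := by
        rw [lintegral_mul_const'' _ hH]
        ring

lemma abs_rpow_sub_rpow_le {s M a b : ℝ} (hs : 1 ≤ s) (ha : 0 ≤ a) (hb : 0 ≤ b) (haM : a ≤ M)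
    (hbM : b ≤ M) : |a ^ s - b ^ s| ≤ s * M ^ (s - 1) * |a - b| := by
  have h := (convex_Icc (0 : ℝ) M).norm_image_sub_le_of_norm_hasDerivWithin_le
    (f := fun x : ℝ => x ^ s) (f' := fun x => s * x ^ (s - 1)) (C := s * M ^ (s - 1))
    (fun x hx => (Real.hasDerivAt_rpow_const (Or.inr hs)).hasDerivWithinAt)
    (fun x hx => by
      rw [Real.norm_eq_abs, abs_of_nonneg (mul_nonneg (by linarith) (Real.rpow_nonneg hx.1 _))]
      exact mul_le_mul_of_nonneg_left (Real.rpow_le_rpow hx.1 hx.2 (by linarith)) (by linarith))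
    ⟨hb, hbM⟩ ⟨ha, haM⟩
  simpa [Real.norm_eq_abs] using h

/-- The integral of a power of the norm over a ball centred at the origin. -/
lemma lintegral_closedBall_norm_rpow_le {n : ℕ} (hn : 1 ≤ n) {α R : ℝ} (hα : -(n : ℝ) < α)
    (hR : 0 < R) :
    ∫⁻ t in {t : Ell n | ‖t‖ ≤ R}, ENNReal.ofReal (‖t‖ ^ α)
      ≤ ENNReal.ofReal
          (n * volume.real (Metric.ball (0 : Ell n) 1) / (α + n) * R ^ (α + n)) := by
  have : NeZero n := ⟨by omega⟩
  have : Nontrivial (Ell n) := inferInstance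
  have hpos : 0 < α + n := by linarith
  set f : ℝ → ℝ := (Set.Iic R).indicator (fun y => y ^ α) with hf
  have hdim : Module.finrank ℝ (Ell n) = n := by simp
  have hEq : Set.EqOn (fun y : ℝ => y ^ (n - 1) • f y)
      ((Set.Ioc 0 R).indicator fun y => y ^ (α + n - 1)) (Set.Ioi 0) := by
    intro y (hy : 0 < y)
    by_cases hyR : y ≤ R
    · have : y ^ (n - 1) = y ^ ((n : ℝ) - 1) := by
        rw [← Real.rpow_natCast, Nat.cast_sub hn, Nat.cast_one]
      simp only [hf, Set.indicator, Set.mem_Iic, hyR, if_true, smul_eq_mul, Set.mem_Ioc, hy,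
        and_self, this]
      rw [← Real.rpow_add hy]
      congr 1; ring
    · simp [hf, Set.indicator, hyR]
  have hII : IntegrableOn (fun y : ℝ => y ^ (α + n - 1)) (Set.Ioc 0 R) := by
    rw [← intervalIntegrable_iff_integrableOn_Ioc_of_le hR.le]
    exact intervalIntegral.intervalIntegrable_rpow' (by linarith)
  have hInt : Integrable (fun t : Ell n => f ‖t‖) := by
    rw [integrable_fun_norm_addHaar (μ := volume) (f := f), hdim,
      integrableOn_congr_fun hEq measurableSet_Ioi]
    exact (hII.integrable_indicator measurableSet_Ioc).integrableOn
  have hval : ∫ t : Ell n, f ‖t‖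
      = n * volume.real (Metric.ball (0 : Ell n) 1) / (α + n) * R ^ (α + n) := by
    rw [integral_fun_norm_addHaar volume f, hdim, setIntegral_congr_fun measurableSet_Ioi hEq,
      setIntegral_indicator measurableSet_Ioc, Set.inter_eq_right.2 (fun y hy => hy.1),
      ← intervalIntegral.integral_of_le hR.le, integral_rpow (Or.inl (by linarith))]
    rw [sub_add_cancel, Real.zero_rpow hpos.ne']
    simp only [nsmul_eq_mul, smul_eq_mul]
    ring
  rw [← hval, ofReal_integral_eq_lintegral_ofReal hInt (ae_of_all _ fun t => by
    simp only [hf, Set.indicator]; split_ifs <;> positivity)]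
  rw [← lintegral_indicator (measurableSet_le measurable_norm measurable_const)]
  refine lintegral_mono fun t => ?_
  by_cases ht : ‖t‖ ≤ R <;> simp [hf, Set.indicator, ht]

/-- The `L¹` norm of `|t| a(t)`, for `a` supported in a ball, is controlled by a weighted
`L²` norm of `a`. -/
lemma sq_lintegral_norm_mul_le {n : ℕ} (hn : 1 ≤ n) {σ R : ℝ}
    (hσ' : σ < (n : ℝ) / 2 + 1) (hR : 0 < R) {a : Ell n → ℝ} (ham : AEMeasurable a)
    (ha0 : ∀ t, 0 ≤ a t) (haR : ∀ t, R < ‖t‖ → a t = 0) :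
    (∫⁻ t, ENNReal.ofReal (‖t‖ * a t)) ^ 2
      ≤ ENNReal.ofReal (n * volume.real (Metric.ball (0 : Ell n) 1) / (n + 2 - 2 * σ)
          * R ^ (n + 2 - 2 * σ)) * ∫⁻ t, ENNReal.ofReal (‖t‖ ^ (2 * σ) * a t ^ 2) := by
  set S : Set (Ell n) := {t | ‖t‖ ≤ R} with hS
  have hSm : MeasurableSet S := measurableSet_le measurable_norm measurable_const
  have hpt (t : Ell n) : ENNReal.ofReal (‖t‖ * a t)
      ≤ S.indicator (fun t => ENNReal.ofReal (‖t‖ ^ (1 - σ))) t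
        * ENNReal.ofReal (‖t‖ ^ σ * a t) := by
    by_cases ht : ‖t‖ ≤ R
    · rw [Set.indicator_of_mem (by exact ht), ← ENNReal.ofReal_mul (by positivity)]
      refine ENNReal.ofReal_le_ofReal ?_
      rcases eq_or_lt_of_le (norm_nonneg t) with h0 | h0
      · rw [← h0, zero_mul]
        have := ha0 t
        positivity
      · rw [← mul_assoc, ← Real.rpow_add h0]
        simp
    · rw [haR t (not_le.1 ht)]
      simp
  have hm1 : Measurable (S.indicator fun t : Ell n => ENNReal.ofReal (‖t‖ ^ (1 - σ))) :=
    Measurable.indicator (by fun_prop) hSm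
  calc (∫⁻ t, ENNReal.ofReal (‖t‖ * a t)) ^ 2
      ≤ (∫⁻ t, S.indicator (fun t => ENNReal.ofReal (‖t‖ ^ (1 - σ))) t
        * ENNReal.ofReal (‖t‖ ^ σ * a t)) ^ 2 := by
        gcongr with t
        exact hpt t
    _ ≤ (∫⁻ t, S.indicator (fun t => ENNReal.ofReal (‖t‖ ^ (1 - σ))) t ^ 2)
        * ∫⁻ t, ENNReal.ofReal (‖t‖ ^ σ * a t) ^ 2 :=
        sq_lintegral_mul_le hm1.aemeasurable (by fun_prop)
    _ = (∫⁻ t in S, ENNReal.ofReal (‖t‖ ^ (2 - 2 * σ)))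
        * ∫⁻ t, ENNReal.ofReal (‖t‖ ^ (2 * σ) * a t ^ 2) := by
        congr 1
        · rw [← lintegral_indicator hSm]
          refine lintegral_congr fun t => ?_
          by_cases ht : t ∈ S
          · rw [Set.indicator_of_mem ht, Set.indicator_of_mem ht,
              ← ENNReal.ofReal_pow (by positivity), ← Real.rpow_mul_natCast (norm_nonneg t)]
            congr 2; push_cast; ring
          · simp [Set.indicator_of_notMem ht]
        · refine lintegral_congr fun t => ?_
          rw [← ENNReal.ofReal_pow (mul_nonneg (by positivity) (ha0 t)), mul_pow,
            ← Real.rpow_mul_natCast (norm_nonneg t)]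
          congr 3; push_cast; ring
    _ ≤ _ := by
        have h := lintegral_closedBall_norm_rpow_le hn (α := 2 - 2 * σ) (by linarith) hR
        rw [show 2 - 2 * σ + n = n + 2 - 2 * σ by ring] at h
        gcongr

end Inequalities

section Commutator

open scoped ENNReal

variable {n : ℕ}

/-- The symbol of `∂ᵢ`, applied to a function on the frequency side. -/
def derivSymbol (i : Fin n) (g : Ell n → ℂ) : Ell n → ℂ :=
  fun ξ => (2 * Real.pi * Complex.I * (ξ i : ℂ)) * g ξ

/-- The symbol of `Λ^s`, applied to a function on the frequency side. -/
def lamSymbol (s : ℝ) (g : Ell n → ℂ) : Ell n → ℂ :=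
  fun ξ => ((‖ξ‖ ^ s : ℝ) : ℂ) * g ξ

lemma continuous_lamSymbol {s : ℝ} (hs : 0 ≤ s) {g : Ell n → ℂ} (hg : Continuous g) :
    Continuous (lamSymbol s g) := by
  unfold lamSymbol
  have : Continuous fun ξ : Ell n => ‖ξ‖ ^ s := continuous_norm.rpow_const fun _ => Or.inr hs
  fun_prop

lemma continuous_derivSymbol (i : Fin n) {g : Ell n → ℂ} (hg : Continuous g) :
    Continuous (derivSymbol i g) := by
  unfold derivSymbol
  fun_prop

lemma contDiff_derivSymbol (i : Fin n) {g : Ell n → ℂ} (hg : ContDiff ℝ (⊤ : ℕ∞) g) :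
    ContDiff ℝ (⊤ : ℕ∞) (derivSymbol i g) := by
  have h : ContDiff ℝ (⊤ : ℕ∞) fun ξ : Ell n => ((ξ i : ℝ) : ℂ) :=
    Complex.ofRealCLM.contDiff.comp (EuclideanSpace.proj (𝕜 := ℝ) i).contDiff
  exact (contDiff_const.mul h).mul hg

lemma norm_derivSymbol_le (i : Fin n) (g : Ell n → ℂ) (ξ : Ell n) :
    ‖derivSymbol i g ξ‖ ≤ 2 * Real.pi * ‖ξ‖ * ‖g ξ‖ := by
  have h : |ξ i| ≤ ‖ξ‖ := by simpa using PiLp.norm_apply_le ξ i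
  simp only [derivSymbol, norm_mul, Complex.norm_ofNat, Complex.norm_real, Complex.norm_I,
    mul_one, Real.norm_eq_abs, abs_of_pos Real.pi_pos]
  gcongr

lemma pd_fourierInv_of_hasCompactSupport {g : Ell n → ℂ} (hg : Continuous g)
    (hgc : HasCompactSupport g) (i : Fin n) : pd i (𝓕⁻ g) = 𝓕⁻ (derivSymbol i g) := by
  refine pd_fourierInv (hg.integrable_of_hasCompactSupport hgc) ?_ i
  exact (continuous_norm.mul hg.norm).integrable_of_hasCompactSupport hgc.norm.mul_left

lemma fourier_finset_sum {ι : Type*} (S : Finset ι) (f : ι → Ell n → ℂ)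
    (hf : ∀ i ∈ S, Integrable (f i)) :
    𝓕 (fun x => ∑ i ∈ S, f i x) = fun ξ => ∑ i ∈ S, 𝓕 (f i) ξ := by
  ext ξ
  simp only [Real.fourier_eq, Finset.smul_sum]
  exact integral_finsetSum _ fun i hi => (Real.fourierIntegral_convergent_iff ξ).2 (hf i hi)

lemma fourierInv_finset_sum {ι : Type*} (S : Finset ι) (f : ι → Ell n → ℂ)
    (hf : ∀ i ∈ S, Integrable (f i)) :
    𝓕⁻ (fun x => ∑ i ∈ S, f i x) = fun ξ => ∑ i ∈ S, 𝓕⁻ (f i) ξ := by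
  ext ξ
  simp only [Real.fourierInv_eq_fourier_neg, fourier_finset_sum S f hf]

lemma fourierInv_sub {f g : Ell n → ℂ} (hf : Integrable f) (hg : Integrable g) (x : Ell n) :
    𝓕⁻ (fun ξ => f ξ - g ξ) x = 𝓕⁻ f x - 𝓕⁻ g x := by
  simp only [Real.fourierInv_eq_fourier_neg, Real.fourier_eq, smul_sub]
  exact integral_sub ((Real.fourierIntegral_convergent_iff _).2 hf)
    ((Real.fourierIntegral_convergent_iff _).2 hg)

/-- The Fourier transform of the commutator of `Λ^s` with the advection by `𝓕⁻ a`, applied to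
`𝓕⁻ g`. -/
def commSymbol (s : ℝ) (a : Fin n → Ell n → ℂ) (g : Ell n → ℂ) : Ell n → ℂ := fun ξ =>
  lamSymbol s (fun ξ => ∑ i, convolution (a i) (derivSymbol i g)
      (ContinuousLinearMap.mul ℂ ℂ) volume ξ) ξ
    - ∑ i, convolution (a i) (derivSymbol i (lamSymbol s g))
      (ContinuousLinearMap.mul ℂ ℂ) volume ξ

variable {s : ℝ} {a : Fin n → Ell n → ℂ} {g : Ell n → ℂ}

lemma integrable_lamSymbol_sum_convolution (hs : 0 ≤ s) (ha : ∀ i, Integrable (a i))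
    (hac : ∀ i, HasCompactSupport (a i)) (hg : Continuous g) (hgc : HasCompactSupport g) :
    Integrable (lamSymbol s fun ξ => ∑ i, convolution (a i) (derivSymbol i g)
      (ContinuousLinearMap.mul ℂ ℂ) volume ξ) := by
  have hb (i : Fin n) : HasCompactSupport (derivSymbol i g) := hgc.mul_left
  have hterm (i : Fin n) : Integrable (lamSymbol s (convolution (a i) (derivSymbol i g)
      (ContinuousLinearMap.mul ℂ ℂ) volume)) := by
    have hcont : Continuous (convolution (a i) (derivSymbol i g)
        (ContinuousLinearMap.mul ℂ ℂ) volume) :=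
      HasCompactSupport.continuous_convolution_right _ (hb i) (ha i).locallyIntegrable
        (continuous_derivSymbol i hg)
    have hsupp : HasCompactSupport (convolution (a i) (derivSymbol i g)
        (ContinuousLinearMap.mul ℂ ℂ) volume) := (hac i).convolution _ (hb i)
    exact (continuous_lamSymbol hs hcont).integrable_of_hasCompactSupport hsupp.mul_left
  have hsum := integrable_finsetSum Finset.univ fun i _ => hterm i
  unfold lamSymbol at hsum ⊢
  simpa only [Finset.mul_sum] using hsum

lemma integrable_sum_convolution (hs : 0 ≤ s) (ha : ∀ i, Integrable (a i)) (hg : Continuous g)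
    (hgc : HasCompactSupport g) :
    Integrable fun ξ => ∑ i, convolution (a i) (derivSymbol i (lamSymbol s g))
      (ContinuousLinearMap.mul ℂ ℂ) volume ξ :=
  integrable_finsetSum _ fun i _ => (ha i).integrable_convolution _
    ((continuous_derivSymbol i (continuous_lamSymbol hs hg)).integrable_of_hasCompactSupport
      hgc.mul_left.mul_left)

lemma commutator_eq_fourierInv (hs : 0 ≤ s) (ha : ∀ i, Integrable (a i))
    (hac : ∀ i, HasCompactSupport (a i)) (hg : ContDiff ℝ (⊤ : ℕ∞) g)
    (hgc : HasCompactSupport g) (x : Ell n) :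
    Lam s (fun y => ∑ i, 𝓕⁻ (a i) y * pd i (𝓕⁻ g) y) x
      - ∑ i, 𝓕⁻ (a i) x * pd i (Lam s (𝓕⁻ g)) x = 𝓕⁻ (commSymbol s a g) x := by
  have hgcont := hg.continuous
  have hlc := continuous_lamSymbol hs hgcont
  have hlcs : HasCompactSupport (lamSymbol s g) := hgc.mul_left
  have hgS : 𝓕 (𝓕⁻ g) = g := by
    have h : 𝓕 (𝓕⁻ (hgc.toSchwartzMap hg)) = hgc.toSchwartzMap hg :=
      FourierTransform.fourier_fourierInv_eq _
    have h' := congrArg (fun h : 𝓢(Ell n, ℂ) => (h : Ell n → ℂ)) h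
    simpa only [SchwartzMap.fourier_coe, SchwartzMap.fourierInv_coe] using! h'
  have hfirst : 𝓕 (fun y => ∑ i, 𝓕⁻ (a i) y * pd i (𝓕⁻ g) y)
      = fun ξ => ∑ i, convolution (a i) (derivSymbol i g)
        (ContinuousLinearMap.mul ℂ ℂ) volume ξ := by
    have hb (i : Fin n) : HasCompactSupport (derivSymbol i g) := hgc.mul_left
    have hS (i : Fin n) :
        ((hb i).toSchwartzMap (contDiff_derivSymbol i hg) : Ell n → ℂ) = derivSymbol i g := rfl
    simp only [pd_fourierInv_of_hasCompactSupport hgcont hgc]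
    rw [fourier_finset_sum]
    · ext ξ
      refine Finset.sum_congr rfl fun i _ => ?_
      rw [← hS i, fourier_fourierInv_mul (ha i)]
    · intro i _
      rw [← hS i]
      exact integrable_fourierInv_mul (ha i) _
  have hLam : Lam s (𝓕⁻ g) = 𝓕⁻ (lamSymbol s g) := by
    rw [Lam, hgS]; rfl
  have hsecond : ∑ i, 𝓕⁻ (a i) x * pd i (Lam s (𝓕⁻ g)) x
      = 𝓕⁻ (fun ξ => ∑ i, convolution (a i) (derivSymbol i (lamSymbol s g))
        (ContinuousLinearMap.mul ℂ ℂ) volume ξ) x := by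
    have h_int (i : Fin n) : Integrable (derivSymbol i (lamSymbol s g)) :=
      (continuous_derivSymbol i hlc).integrable_of_hasCompactSupport hlcs.mul_left
    rw [hLam, fourierInv_finset_sum _ _ fun i _ => (ha i).integrable_convolution _ (h_int i)]
    refine Finset.sum_congr rfl fun i _ => ?_
    rw [fourierInv_convolution (ha i) (h_int i), pd_fourierInv_of_hasCompactSupport hlc hlcs]
  rw [hsecond, Lam, hfirst]
  exact (fourierInv_sub (integrable_lamSymbol_sum_convolution hs ha hac hgcont hgc)
    (integrable_sum_convolution hs ha hgcont hgc) x).symm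

/-- Pointwise bound of the commutator symbol by a convolution. -/
lemma enorm_commSymbol_le (hs : 1 ≤ s) {M : ℝ} (ha : ∀ i, Integrable (a i))
    (haM : ∀ i t, a i t ≠ 0 → ‖t‖ ≤ M) (hg : Continuous g) (hgc : HasCompactSupport g)
    (hgM : ∀ ξ, g ξ ≠ 0 → ‖ξ‖ ≤ M) (hM : 0 ≤ M) (ξ : Ell n) :
    ‖commSymbol s a g ξ‖ₑ ≤ ∫⁻ t, (∑ i, ENNReal.ofReal (‖t‖ * ‖a i t‖))
      * ENNReal.ofReal (2 * Real.pi * M * (s * (2 * M) ^ (s - 1)) * ‖g (ξ - t)‖) := by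
  have hs0 : 0 ≤ s := by linarith
  have hex1 (i : Fin n) : Integrable fun t => a i t * derivSymbol i g (ξ - t) :=
    HasCompactSupport.convolutionExists_right (ContinuousLinearMap.mul ℂ ℂ) hgc.mul_left
      (ha i).locallyIntegrable (continuous_derivSymbol i hg) ξ
  have hex2 (i : Fin n) : Integrable fun t => a i t * derivSymbol i (lamSymbol s g) (ξ - t) :=
    HasCompactSupport.convolutionExists_right (ContinuousLinearMap.mul ℂ ℂ) hgc.mul_left.mul_left
      (ha i).locallyIntegrable (continuous_derivSymbol i (continuous_lamSymbol hs0 hg)) ξ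
  have hK : commSymbol s a g ξ = ∫ t, ∑ i, a i t * (derivSymbol i g (ξ - t)
      * (((‖ξ‖ ^ s - ‖ξ - t‖ ^ s : ℝ)) : ℂ)) := by
    have hrw (i : Fin n) : (fun t => a i t * (derivSymbol i g (ξ - t)
        * (((‖ξ‖ ^ s - ‖ξ - t‖ ^ s : ℝ)) : ℂ)))
        = fun t => ((‖ξ‖ ^ s : ℝ) : ℂ) * (a i t * derivSymbol i g (ξ - t))
          - a i t * derivSymbol i (lamSymbol s g) (ξ - t) := by
      ext t
      simp only [derivSymbol, lamSymbol]
      push_cast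
      ring
    rw [integral_finsetSum]
    · simp only [commSymbol, lamSymbol, Finset.mul_sum, ← Finset.sum_sub_distrib]
      refine Finset.sum_congr rfl fun i _ => ?_
      rw [hrw i, integral_sub ((hex1 i).const_mul _) (hex2 i), integral_const_mul]
      rfl
    · intro i _
      rw [hrw i]
      exact ((hex1 i).const_mul _).sub (hex2 i)
  rw [hK]
  refine (enorm_integral_le_lintegral_enorm _).trans (lintegral_mono fun t => ?_)
  rw [Finset.sum_mul]
  refine (enorm_sum_le _ _).trans (Finset.sum_le_sum fun i _ => ?_)
  rw [← ENNReal.ofReal_mul (by positivity), ← ofReal_norm]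
  refine ENNReal.ofReal_le_ofReal ?_
  by_cases hat : a i t = 0
  · simp [hat]
  by_cases hgt : g (ξ - t) = 0
  · simp [derivSymbol, hgt]
  have h1 := haM i t hat
  have h2 := hgM _ hgt
  have h3 : ‖ξ‖ ≤ 2 * M := by
    have := norm_add_le (ξ - t) t
    rw [sub_add_cancel] at this
    linarith
  have h4 : |‖ξ‖ ^ s - ‖ξ - t‖ ^ s| ≤ s * (2 * M) ^ (s - 1) * ‖t‖ := by
    refine (abs_rpow_sub_rpow_le hs (norm_nonneg _) (norm_nonneg _) h3 (by linarith)).trans ?_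
    have h5 : |‖ξ‖ - ‖ξ - t‖| ≤ ‖t‖ := by simpa using abs_norm_sub_norm_le ξ (ξ - t)
    gcongr
  rw [norm_mul, norm_mul, Complex.norm_real, Real.norm_eq_abs]
  calc ‖a i t‖ * (‖derivSymbol i g (ξ - t)‖ * |‖ξ‖ ^ s - ‖ξ - t‖ ^ s|)
      ≤ ‖a i t‖ * ((2 * Real.pi * M * ‖g (ξ - t)‖) * (s * (2 * M) ^ (s - 1) * ‖t‖)) := by
        refine mul_le_mul_of_nonneg_left (mul_le_mul ?_ h4 (abs_nonneg _) ?_) (norm_nonneg _)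
        · refine (norm_derivSymbol_le i g _).trans ?_
          have := Real.pi_pos
          gcongr
        · have := Real.pi_pos
          positivity
    _ = _ := by ring

end Commutator

section Commutator

open scoped ENNReal

variable {n : ℕ} {s : ℝ} {a : Fin n → Ell n → ℂ} {g : Ell n → ℂ}

lemma aemeasurable_ofReal_norm_mul {f : Ell n → ℂ} (hf : Integrable f) :
    AEMeasurable fun t => ENNReal.ofReal (‖t‖ * ‖f t‖) := by
  have := hf.aestronglyMeasurable.aemeasurable
  fun_prop

lemma lintegral_sum_norm_mul_le (ha : ∀ i, Integrable (a i)) {A : ℝ}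
    (haA : ∀ i, ∫⁻ t, ENNReal.ofReal (‖t‖ * ‖a i t‖) ≤ ENNReal.ofReal A) :
    ∫⁻ t, ∑ i, ENNReal.ofReal (‖t‖ * ‖a i t‖) ≤ ENNReal.ofReal (n * A) := by
  rw [lintegral_finsetSum' _ fun i _ => aemeasurable_ofReal_norm_mul (ha i)]
  refine (Finset.sum_le_sum fun i _ => haA i).trans ?_
  simp [ENNReal.ofReal_mul]

lemma lintegral_enorm_sq_commSymbol_le (hs : 1 ≤ s) {M : ℝ} (hM : 0 ≤ M)
    (ha : ∀ i, Integrable (a i)) (haM : ∀ i t, a i t ≠ 0 → ‖t‖ ≤ M) (hg : Continuous g)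
    (hgc : HasCompactSupport g) (hgM : ∀ ξ, g ξ ≠ 0 → ‖ξ‖ ≤ M) {A : ℝ} (hA : 0 ≤ A)
    (haA : ∀ i, ∫⁻ t, ENNReal.ofReal (‖t‖ * ‖a i t‖) ≤ ENNReal.ofReal A) :
    ∫⁻ ξ, ‖commSymbol s a g ξ‖ₑ ^ 2 ≤ ENNReal.ofReal ((n * A) ^ 2 *
      (2 * Real.pi * M * (s * (2 * M) ^ (s - 1))) ^ 2 * ∫ ξ, ‖g ξ‖ ^ 2) := by
  have hpt := enorm_commSymbol_le hs ha haM hg hgc hgM hM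
  have hC0 : 0 ≤ 2 * Real.pi * M * (s * (2 * M) ^ (s - 1)) := by
    have := Real.pi_pos
    positivity
  generalize 2 * Real.pi * M * (s * (2 * M) ^ (s - 1)) = C at hpt hC0 ⊢
  have hg2 : Integrable fun ξ => ‖g ξ‖ ^ 2 := by
    refine (hg.norm.pow 2).integrable_of_hasCompactSupport ?_
    simp_rw [pow_two]
    exact hgc.norm.mul_left
  have hHm : AEMeasurable fun t => ∑ i, ENNReal.ofReal (‖t‖ * ‖a i t‖) :=
    Finset.aemeasurable_fun_sum _ fun i _ => aemeasurable_ofReal_norm_mul (ha i)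
  have hGm : Measurable fun ξ => ENNReal.ofReal (C * ‖g ξ‖) := by
    have := hg.measurable
    fun_prop
  have hG2 : ∫⁻ ξ, ENNReal.ofReal (C * ‖g ξ‖) ^ 2 = ENNReal.ofReal (C ^ 2 * ∫ ξ, ‖g ξ‖ ^ 2) := by
    rw [← integral_const_mul, ofReal_integral_eq_lintegral_ofReal (hg2.const_mul _)
      (ae_of_all _ fun ξ => by positivity)]
    refine lintegral_congr fun ξ => ?_
    rw [← ENNReal.ofReal_pow (by positivity), mul_pow]
  calc ∫⁻ ξ, ‖commSymbol s a g ξ‖ₑ ^ 2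
      ≤ ∫⁻ ξ, (∫⁻ t, (∑ i, ENNReal.ofReal (‖t‖ * ‖a i t‖))
          * ENNReal.ofReal (C * ‖g (ξ - t)‖)) ^ 2 :=
        lintegral_mono fun ξ => by gcongr; exact hpt ξ
    _ ≤ (∫⁻ t, ∑ i, ENNReal.ofReal (‖t‖ * ‖a i t‖)) ^ 2
          * ∫⁻ ξ, ENNReal.ofReal (C * ‖g ξ‖) ^ 2 := lintegral_sq_conv_le hHm hGm
    _ ≤ ENNReal.ofReal (n * A) ^ 2 * ENNReal.ofReal (C ^ 2 * ∫ ξ, ‖g ξ‖ ^ 2) := by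
        rw [hG2]
        gcongr
        exact lintegral_sum_norm_mul_le ha haA
    _ = _ := by
        rw [← ENNReal.ofReal_pow (by positivity), ← ENNReal.ofReal_mul (by positivity), mul_assoc]

/-- The `L²` estimate of the commutator for compactly supported frequencies. -/
lemma integral_norm_sq_commutator_le (hs : 1 ≤ s) {M : ℝ} (hM : 0 ≤ M)
    (ha : ∀ i, Integrable (a i)) (haM : ∀ i t, a i t ≠ 0 → ‖t‖ ≤ M)
    (hg : ContDiff ℝ (⊤ : ℕ∞) g) (hgM : ∀ ξ, g ξ ≠ 0 → ‖ξ‖ ≤ M) {A : ℝ} (hA : 0 ≤ A)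
    (haA : ∀ i, ∫⁻ t, ENNReal.ofReal (‖t‖ * ‖a i t‖) ≤ ENNReal.ofReal A) :
    ∫ x, ‖Lam s (fun y => ∑ i, 𝓕⁻ (a i) y * pd i (𝓕⁻ g) y) x
      - ∑ i, 𝓕⁻ (a i) x * pd i (Lam s (𝓕⁻ g)) x‖ ^ 2
    ≤ (n * A) ^ 2 * (2 * Real.pi * M * (s * (2 * M) ^ (s - 1))) ^ 2 * ∫ ξ, ‖g ξ‖ ^ 2 := by
  have hs0 : 0 ≤ s := by linarith
  have hgcont := hg.continuous
  have hcs {f : Ell n → ℂ} (hf : ∀ ξ, f ξ ≠ 0 → ‖ξ‖ ≤ M) : HasCompactSupport f :=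
    HasCompactSupport.intro (isCompact_closedBall (0 : Ell n) M) fun ξ hξ => by
      by_contra h
      exact hξ (mem_closedBall_zero_iff.2 (hf ξ h))
  have hac (i : Fin n) : HasCompactSupport (a i) := hcs (haM i)
  have hgc : HasCompactSupport g := hcs hgM
  have hKint : Integrable (commSymbol s a g) :=
    (integrable_lamSymbol_sum_convolution hs0 ha hac hgcont hgc).sub
      (integrable_sum_convolution hs0 ha hgcont hgc)
  have hlint := lintegral_enorm_sq_commSymbol_le hs hM ha haM hgcont hgc hgM hA haA
  have hKL2 : MemLp (commSymbol s a g) 2 := by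
    refine ⟨hKint.aestronglyMeasurable, ?_⟩
    rw [eLpNorm_lt_top_iff_lintegral_rpow_enorm_lt_top (by norm_num) (by norm_num)]
    simpa using hlint.trans_lt ENNReal.ofReal_lt_top
  simp_rw [commutator_eq_fourierInv hs0 ha hac hg hgc]
  have hm : AEStronglyMeasurable (fun ξ => ‖commSymbol s a g ξ‖ ^ 2) volume :=
    hKint.aestronglyMeasurable.norm.pow 2
  rw [integral_norm_sq_fourierInv hKint hKL2, integral_eq_lintegral_of_nonneg_ae
    (ae_of_all _ fun x => by positivity) hm]
  refine ENNReal.toReal_le_of_le_ofReal (by positivity) ?_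
  simpa only [ENNReal.ofReal_pow (norm_nonneg _), ofReal_norm] using hlint

end Commutator

section LittlewoodPaley

variable {n : ℕ} {φ : Ell n → ℝ}

lemma LPFunction.nonneg (hφ : LPFunction φ) (ξ : Ell n) : 0 ≤ φ ξ := (hφ.2.2.2.1 ξ).1

lemma LPFunction.le_one (hφ : LPFunction φ) (ξ : Ell n) : φ ξ ≤ 1 := (hφ.2.2.2.1 ξ).2

lemma LPFunction.apply_zero (hφ : LPFunction φ) : φ 0 = 0 := by
  by_contra h
  have := (hφ.2.2.1 0 h).1
  norm_num at this

lemma LPFunction.summable (hφ : LPFunction φ) (ξ : Ell n) :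
    Summable fun j : ℤ => φ ((2 : ℝ) ^ (-j) • ξ) := by
  rcases eq_or_ne ξ 0 with rfl | hξ
  · simp [hφ.apply_zero]
  · by_contra h
    have := hφ.2.2.2.2.2.1 ξ hξ
    rw [tsum_eq_zero_of_not_summable h] at this
    exact zero_ne_one this

lemma LPFunction.tsum_le_one (hφ : LPFunction φ) (ξ : Ell n) :
    ∑' j : ℤ, φ ((2 : ℝ) ^ (-j) • ξ) ≤ 1 := by
  rcases eq_or_ne ξ 0 with rfl | hξ
  · simp [hφ.apply_zero]
  · exact (hφ.2.2.2.2.2.1 ξ hξ).le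

lemma norm_two_zpow_neg_smul (j : ℤ) (ξ : Ell n) :
    ‖(2 : ℝ) ^ (-j) • ξ‖ = ‖ξ‖ / (2 : ℝ) ^ j := by
  rw [norm_smul, norm_zpow, Real.norm_ofNat, zpow_neg, inv_mul_eq_div]

lemma LPFunction.le_norm (hφ : LPFunction φ) {j : ℤ} {ξ : Ell n}
    (h : φ ((2 : ℝ) ^ (-j) • ξ) ≠ 0) : 3 / 4 * (2 : ℝ) ^ j ≤ ‖ξ‖ := by
  have := (hφ.2.2.1 _ h).1
  rwa [norm_two_zpow_neg_smul, le_div_iff₀ (by positivity)] at this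

lemma LPFunction.norm_le (hφ : LPFunction φ) {j : ℤ} {ξ : Ell n}
    (h : φ ((2 : ℝ) ^ (-j) • ξ) ≠ 0) : ‖ξ‖ ≤ 8 / 3 * (2 : ℝ) ^ j := by
  have := (hφ.2.2.1 _ h).2
  rwa [norm_two_zpow_neg_smul, div_le_iff₀ (by positivity)] at this

/-- The symbol of the low-frequency cutoff `Ṡ_j`. -/
def lowCut (φ : Ell n → ℝ) (j : ℤ) (ξ : Ell n) : ℝ :=
  ∑' j' : ℤ, if j' ≤ j - 1 then φ ((2 : ℝ) ^ (-j') • ξ) else 0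

lemma LPFunction.summable_lowCut (hφ : LPFunction φ) (j : ℤ) (ξ : Ell n) :
    Summable fun j' : ℤ => if j' ≤ j - 1 then φ ((2 : ℝ) ^ (-j') • ξ) else 0 := by
  refine (hφ.summable ξ).of_nonneg_of_le (fun j' => ?_) fun j' => ?_
  · split_ifs <;> simp [hφ.nonneg]
  · split_ifs <;> simp [hφ.nonneg]

lemma LPFunction.lowCut_nonneg (hφ : LPFunction φ) (j : ℤ) (ξ : Ell n) : 0 ≤ lowCut φ j ξ :=
  tsum_nonneg fun j' => by split_ifs <;> simp [hφ.nonneg]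

lemma LPFunction.lowCut_le_one (hφ : LPFunction φ) (j : ℤ) (ξ : Ell n) : lowCut φ j ξ ≤ 1 := by
  refine ((hφ.summable_lowCut j ξ).tsum_le_tsum (fun j' => ?_) (hφ.summable ξ)).trans
    (hφ.tsum_le_one ξ)
  split_ifs <;> simp [hφ.nonneg]

lemma LPFunction.norm_le_of_lowCut_ne_zero (hφ : LPFunction φ) {j : ℤ} {ξ : Ell n}
    (h : lowCut φ j ξ ≠ 0) : ‖ξ‖ ≤ 8 / 3 * (2 : ℝ) ^ (j - 1) := by
  contrapose! h
  refine (tsum_congr fun j' => ?_).trans tsum_zero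
  split_ifs with hj
  · by_contra h'
    have := hφ.norm_le h'
    have h2 : (2 : ℝ) ^ j' ≤ 2 ^ (j - 1) := zpow_le_zpow_right₀ (by norm_num) hj
    linarith
  · rfl

lemma LPFunction.measurable_lowCut (hφ : LPFunction φ) (j : ℤ) : Measurable (lowCut φ j) := by
  refine Measurable.tsum fun j' => ?_
  have := hφ.1.continuous
  split_ifs
  · exact Continuous.measurable (by fun_prop)
  · exact measurable_const

/-- The low-frequency cutoff is a Fourier multiplier. -/
lemma SJ_eq_fourierInv (hφ : LPFunction φ) (j : ℤ) {f : Ell n → ℂ} (hf : Integrable (𝓕 f)) :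
    SJ φ j f = 𝓕⁻ (fun ξ => ((lowCut φ j ξ : ℝ) : ℂ) * 𝓕 f ξ) := by
  have hφc := hφ.1.continuous
  ext x
  have hsum (ξ : Ell n) : Summable fun j' : ℤ => φ ((2 : ℝ) ^ (-j') • ξ) * ‖𝓕 f ξ‖ :=
    (hφ.summable ξ).mul_right _
  have key := hasSum_integral_of_dominated_convergence (μ := (volume : Measure (Ell n)))
    (F := fun (j' : ℤ) ξ => if j' ≤ j - 1 then
      Real.fourierChar (inner ℝ ξ x) • (((φ ((2 : ℝ) ^ (-j') • ξ) : ℝ) : ℂ) * 𝓕 f ξ) else 0)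
    (f := fun ξ => Real.fourierChar (inner ℝ ξ x) • (((lowCut φ j ξ : ℝ) : ℂ) * 𝓕 f ξ))
    (fun j' ξ => φ ((2 : ℝ) ^ (-j') • ξ) * ‖𝓕 f ξ‖) ?_ ?_ ?_ ?_ ?_
  · rw [SJ, Real.fourierInv_eq, ← key.tsum_eq]
    refine tsum_congr fun j' => ?_
    split_ifs
    · rw [DeltaJ, Real.fourierInv_eq]
    · simp
  · intro j'
    split_ifs
    · have h1 : Continuous fun ξ : Ell n => Real.fourierChar (inner ℝ ξ x) := by fun_prop
      have h2 : Continuous fun ξ : Ell n => ((φ ((2 : ℝ) ^ (-j') • ξ) : ℝ) : ℂ) := by fun_prop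
      exact h1.aestronglyMeasurable.smul (h2.aestronglyMeasurable.mul hf.aestronglyMeasurable)
    · exact aestronglyMeasurable_const
  · intro j'
    refine ae_of_all _ fun ξ => ?_
    have := hφ.nonneg ((2 : ℝ) ^ (-j') • ξ)
    split_ifs
    · rw [Circle.norm_smul, norm_mul, Complex.norm_of_nonneg this]
    · simpa using mul_nonneg this (norm_nonneg _)
  · exact ae_of_all _ hsum
  · refine hf.norm.mono' ?_ (ae_of_all _ fun ξ => ?_)
    · simp_rw [tsum_mul_right]
      refine AEStronglyMeasurable.mul ?_ hf.norm.aestronglyMeasurable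
      refine (Measurable.tsum fun j' => ?_).aestronglyMeasurable
      exact Continuous.measurable (by fun_prop)
    · rw [tsum_mul_right, Real.norm_of_nonneg
        (mul_nonneg (tsum_nonneg fun _ => hφ.nonneg _) (norm_nonneg _))]
      exact mul_le_of_le_one_left (norm_nonneg _) (hφ.tsum_le_one ξ)
  · refine ae_of_all _ fun ξ => ?_
    have h : HasSum (fun j' : ℤ => (((if j' ≤ j - 1 then φ ((2 : ℝ) ^ (-j') • ξ) else 0 : ℝ) : ℂ)))
        ((lowCut φ j ξ : ℝ) : ℂ) :=
      Complex.hasSum_ofReal.2 (hφ.summable_lowCut j ξ).hasSum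
    have h' := (h.mul_right (𝓕 f ξ)).const_smul (Real.fourierChar (inner ℝ ξ x))
    refine h'.congr_fun fun j' => ?_
    split_ifs <;> simp

end LittlewoodPaley

section Sobolev

variable {n : ℕ}

/-- A real-valued Schwartz function, viewed as a complex-valued one. -/
def complexify (f : 𝓢(Ell n, ℝ)) : 𝓢(Ell n, ℂ) :=
  SchwartzMap.postcompCLM Complex.ofRealCLM f

lemma fourier_cf (f : 𝓢(Ell n, ℝ)) : 𝓕 (cf fun x => f x) = ⇑(𝓕 (complexify f) : 𝓢(Ell n, ℂ)) := by
  rw [SchwartzMap.fourier_coe]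
  rfl

lemma integrable_rpow_mul_norm_sq (f : 𝓢(Ell n, ℂ)) {σ : ℝ} (hσ : 0 ≤ σ) :
    Integrable fun ξ => ‖ξ‖ ^ (2 * σ) * ‖f ξ‖ ^ 2 := by
  obtain ⟨k, hk⟩ := exists_nat_ge (2 * σ)
  obtain ⟨C, hC⟩ := f.decay 0 0
  have hC' (ξ : Ell n) : ‖f ξ‖ ≤ C := by simpa using hC.2 ξ
  have h_int : Integrable fun ξ : Ell n => C * (‖ξ‖ ^ 0 * ‖f ξ‖ + ‖ξ‖ ^ k * ‖f ξ‖) :=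
    ((f.integrable_pow_mul volume 0).add (f.integrable_pow_mul volume k)).const_mul C
  have hm : Continuous fun ξ : Ell n => ‖ξ‖ ^ (2 * σ) * ‖f ξ‖ ^ 2 :=
    (continuous_norm.rpow_const fun _ => Or.inr (by positivity)).mul (f.continuous.norm.pow 2)
  refine h_int.mono' hm.aestronglyMeasurable (ae_of_all _ fun ξ => ?_)
  have h1 : ‖ξ‖ ^ (2 * σ) ≤ 1 + ‖ξ‖ ^ k := by
    rcases le_total ‖ξ‖ 1 with h | h
    · have := Real.rpow_le_one (norm_nonneg ξ) h (by positivity : 0 ≤ 2 * σ)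
      have : 0 ≤ ‖ξ‖ ^ k := by positivity
      linarith
    · have := Real.rpow_le_rpow_of_exponent_le h hk
      rw [Real.rpow_natCast] at this
      linarith
  rw [Real.norm_of_nonneg (by positivity)]
  calc ‖ξ‖ ^ (2 * σ) * ‖f ξ‖ ^ 2 ≤ (1 + ‖ξ‖ ^ k) * (C * ‖f ξ‖) := by
        rw [pow_two]
        gcongr
        exact hC' ξ
    _ = _ := by ring

lemma HsqC_nonneg (σ : ℝ) (f : Ell n → ℂ) : 0 ≤ HsqC σ f :=
  integral_nonneg fun ξ => by positivity

lemma Hnorm_sq (σ : ℝ) (u : Fin n → Ell n → ℝ) :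
    Hnorm σ u ^ 2 = ∑ l, HsqC σ (cf (u l)) :=
  Real.sq_sqrt (Finset.sum_nonneg fun _ _ => HsqC_nonneg _ _)

end Sobolev

section DyadicEstimates

variable {n : ℕ} {φ : Ell n → ℝ}

lemma LPFunction.contDiff_dyadic (hφ : LPFunction φ) (j : ℤ) :
    ContDiff ℝ (⊤ : ℕ∞) fun ξ : Ell n => φ ((2 : ℝ) ^ (-j) • ξ) :=
  hφ.1.comp (contDiff_const_smul _)

lemma LPFunction.integrable_lowCut_mul (hφ : LPFunction φ) (j : ℤ) {f : Ell n → ℂ}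
    (hf : Integrable f) : Integrable fun ξ => ((lowCut φ j ξ : ℝ) : ℂ) * f ξ := by
  refine hf.norm.mono' ?_ (ae_of_all _ fun ξ => ?_)
  · have := hφ.measurable_lowCut j
    exact AEStronglyMeasurable.mul (Measurable.aestronglyMeasurable (by fun_prop))
      hf.aestronglyMeasurable
  · rw [norm_mul, Complex.norm_of_nonneg (hφ.lowCut_nonneg j ξ)]
    exact mul_le_of_le_one_left (norm_nonneg _) (hφ.lowCut_le_one j ξ)

/-- The Lipschitz-type bound of the low-frequency part by a homogeneous Sobolev norm. -/
lemma LPFunction.lintegral_norm_mul_lowCut_le (hφ : LPFunction φ) (hn : 1 ≤ n) {σ R : ℝ}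
    (hσ : 0 ≤ σ) (hσ' : σ < (n : ℝ) / 2 + 1) (j : ℤ) (hR : 8 / 3 * (2 : ℝ) ^ (j - 1) ≤ R)
    (f : 𝓢(Ell n, ℂ)) :
    ∫⁻ t, ENNReal.ofReal (‖t‖ * ‖((lowCut φ j t : ℝ) : ℂ) * f t‖) ≤
      ENNReal.ofReal (√(n * volume.real (Metric.ball (0 : Ell n) 1) / (n + 2 - 2 * σ)
        * R ^ (n + 2 - 2 * σ) * ∫ t, ‖t‖ ^ (2 * σ) * ‖f t‖ ^ 2)) := by
  have hR0 : 0 < R := lt_of_lt_of_le (by positivity) hR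
  have hD : 0 ≤ n * volume.real (Metric.ball (0 : Ell n) 1) / (n + 2 - 2 * σ)
      * R ^ (n + 2 - 2 * σ) := by
    have : 0 ≤ (n : ℝ) + 2 - 2 * σ := by linarith
    positivity
  have hI : 0 ≤ ∫ t, ‖t‖ ^ (2 * σ) * ‖f t‖ ^ 2 := integral_nonneg fun ξ => by positivity
  have ham : AEMeasurable fun t => ‖((lowCut φ j t : ℝ) : ℂ) * f t‖ :=
    (hφ.integrable_lowCut_mul j f.integrable).norm.aemeasurable
  have h := sq_lintegral_norm_mul_le hn hσ' hR0 ham (fun _ => norm_nonneg _) fun t ht => by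
    by_contra h
    have h' : lowCut φ j t ≠ 0 := fun h0 => h (by simp [h0])
    linarith [hφ.norm_le_of_lowCut_ne_zero h']
  rw [← ENNReal.pow_le_pow_left_iff two_ne_zero, ← ENNReal.ofReal_pow (Real.sqrt_nonneg _),
    Real.sq_sqrt (by positivity), ENNReal.ofReal_mul hD]
  refine h.trans ?_
  gcongr
  rw [ofReal_integral_eq_lintegral_ofReal (integrable_rpow_mul_norm_sq f hσ)
    (ae_of_all _ fun ξ => by positivity)]
  refine lintegral_mono fun t => ENNReal.ofReal_le_ofReal ?_
  gcongr
  rw [norm_mul, Complex.norm_of_nonneg (hφ.lowCut_nonneg j t)]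
  exact mul_le_of_le_one_left (norm_nonneg _) (hφ.lowCut_le_one j t)

lemma rpow_mul_sq_symbol_bound {M d s s₂ : ℝ} (hM : 0 < M) (h : d + 2 * s = 2 * s₂) :
    M ^ d * (2 * Real.pi * M * (s * (2 * M) ^ (s - 1))) ^ 2
      = (Real.pi * s * 2 ^ s) ^ 2 * M ^ (2 * s₂) := by
  have h1 : 2 * M * (2 * M) ^ (s - 1) = 2 ^ s * M ^ s := by
    rw [← Real.mul_rpow (by norm_num) hM.le, Real.rpow_sub_one (by positivity)]
    field_simp
  have h2 : M ^ (2 * s₂) = M ^ d * (M ^ s) ^ 2 := by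
    rw [← h, Real.rpow_add hM, ← Real.rpow_natCast (M ^ s), ← Real.rpow_mul hM.le]
    norm_num [mul_comm]
  rw [h2]
  calc _ = M ^ d * (Real.pi * s * (2 * M * (2 * M) ^ (s - 1))) ^ 2 := by ring
    _ = _ := by rw [h1]; ring

/-- The commutator estimate for a single dyadic block. -/
lemma LPFunction.integral_norm_sq_commutator_le (hφ : LPFunction φ) (hn : 1 ≤ n) {s s₁ s₂ : ℝ}
    (hs : 1 ≤ s) (hs₁ : 0 ≤ s₁) (hs₁' : s₁ < (n : ℝ) / 2 + 1)
    (hsum : s₁ + s₂ = s + (n : ℝ) / 2 + 1) (u : Fin n → 𝓢(Ell n, ℝ)) (b : 𝓢(Ell n, ℝ)) (j : ℤ) :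
    ∫ x, ‖Lam s (fun y => ∑ i, SJ φ (j - 9) (cf (u i)) y * pd i (DeltaJ φ j (cf b)) y) x
      - ∑ i, SJ φ (j - 9) (cf (u i)) x * pd i (Lam s (DeltaJ φ j (cf b))) x‖ ^ 2
    ≤ n ^ 2 * (n * volume.real (Metric.ball (0 : Ell n) 1) / (n + 2 - 2 * s₁))
      * (Real.pi * s * 2 ^ s) ^ 2 * Hnorm s₁ (fun l x => u l x) ^ 2
      * ((8 / 3 * (2 : ℝ) ^ j) ^ (2 * s₂)
        * ∫ ξ, ‖((φ ((2 : ℝ) ^ (-j) • ξ) : ℝ) : ℂ) * 𝓕 (cf b) ξ‖ ^ 2) := by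
  have hM : (0 : ℝ) < 8 / 3 * 2 ^ j := by positivity
  have hlow : (8 / 3 : ℝ) * 2 ^ (j - 9 - 1) ≤ 8 / 3 * 2 ^ j := by
    gcongr
    · norm_num
    · omega
  set D := n * volume.real (Metric.ball (0 : Ell n) 1) / (n + 2 - 2 * s₁)
    * (8 / 3 * (2 : ℝ) ^ j) ^ (n + 2 - 2 * s₁) with hDdef
  have hD : 0 ≤ D := by
    have : 0 ≤ (n : ℝ) + 2 - 2 * s₁ := by linarith
    positivity
  have hU : Hnorm s₁ (fun l x => u l x) ^ 2 = ∑ i, HsqC s₁ (cf (u i)) := Hnorm_sq _ _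
  have h_int (f : 𝓢(Ell n, ℝ)) : Integrable (𝓕 (cf f)) := by
    rw [fourier_cf]
    exact SchwartzMap.integrable _
  have hA (i : Fin n) :
      ∫⁻ t, ENNReal.ofReal (‖t‖ * ‖((lowCut φ (j - 9) t : ℝ) : ℂ) * 𝓕 (cf (u i)) t‖) ≤
        ENNReal.ofReal (√(D * Hnorm s₁ (fun l x => u l x) ^ 2)) := by
    have h := hφ.lintegral_norm_mul_lowCut_le hn hs₁ hs₁' (j - 9) hlow
      (𝓕 (complexify (u i)))
    rw [← fourier_cf] at h
    refine h.trans (ENNReal.ofReal_le_ofReal (Real.sqrt_le_sqrt ?_))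
    refine mul_le_mul_of_nonneg_left ?_ hD
    rw [hU]
    exact Finset.single_le_sum (f := fun i => HsqC s₁ (cf (u i)))
      (fun i _ => HsqC_nonneg _ _) (Finset.mem_univ i)
  have hg : ContDiff ℝ (⊤ : ℕ∞) fun ξ => ((φ ((2 : ℝ) ^ (-j) • ξ) : ℝ) : ℂ) * 𝓕 (cf b) ξ := by
    rw [fourier_cf]
    exact (Complex.ofRealCLM.contDiff.comp (hφ.contDiff_dyadic j)).mul (SchwartzMap.smooth _ _)
  have key := _root_.integral_norm_sq_commutator_le hs hM.le
    (fun i => hφ.integrable_lowCut_mul (j - 9) (h_int (u i)))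
    (fun i t ht => (hφ.norm_le_of_lowCut_ne_zero fun h0 => ht (by simp [h0])).trans hlow)
    hg (fun ξ hξ => hφ.norm_le fun h0 => hξ (by rw [h0, Complex.ofReal_zero, zero_mul]))
    (Real.sqrt_nonneg _) hA
  simp_rw [SJ_eq_fourierInv hφ (j - 9) (h_int (u _)), DeltaJ]
  refine key.trans_eq ?_
  have hpow := rpow_mul_sq_symbol_bound (d := n + 2 - 2 * s₁) (s := s) (s₂ := s₂) hM (by linarith)
  rw [mul_pow, Real.sq_sqrt (by positivity), hDdef]
  linear_combination (n : ℝ) ^ 2 * (n * volume.real (Metric.ball (0 : Ell n) 1) / (n + 2 - 2 * s₁))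
    * Hnorm s₁ (fun l x => u l x) ^ 2
    * (∫ ξ, ‖((φ ((2 : ℝ) ^ (-j) • ξ) : ℝ) : ℂ) * 𝓕 (cf b) ξ‖ ^ 2) * hpow

/-- Almost orthogonality of the dyadic blocks. -/
lemma LPFunction.sum_rpow_mul_integral_le (hφ : LPFunction φ) {σ : ℝ} (hσ : 0 ≤ σ)
    (b : 𝓢(Ell n, ℝ)) (F : Finset ℤ) :
    ∑ j ∈ F, (8 / 3 * (2 : ℝ) ^ j) ^ (2 * σ)
        * ∫ ξ, ‖((φ ((2 : ℝ) ^ (-j) • ξ) : ℝ) : ℂ) * 𝓕 (cf b) ξ‖ ^ 2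
      ≤ (32 / 9) ^ (2 * σ) * HsqC σ (cf b) := by
  have hb : Integrable fun ξ => ‖ξ‖ ^ (2 * σ) * ‖𝓕 (cf b) ξ‖ ^ 2 := by
    rw [fourier_cf]
    exact integrable_rpow_mul_norm_sq _ hσ
  have hpt (j : ℤ) (ξ : Ell n) : (8 / 3 * (2 : ℝ) ^ j) ^ (2 * σ) *
      ‖((φ ((2 : ℝ) ^ (-j) • ξ) : ℝ) : ℂ) * 𝓕 (cf b) ξ‖ ^ 2 ≤
      φ ((2 : ℝ) ^ (-j) • ξ) * ((32 / 9) ^ (2 * σ) * (‖ξ‖ ^ (2 * σ) * ‖𝓕 (cf b) ξ‖ ^ 2)) := by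
    have h0 := hφ.nonneg ((2 : ℝ) ^ (-j) • ξ)
    rw [norm_mul, Complex.norm_of_nonneg h0]
    by_cases h : φ ((2 : ℝ) ^ (-j) • ξ) = 0
    · rw [h]
      simp
    have h1 : (8 / 3 * (2 : ℝ) ^ j) ^ (2 * σ) ≤ (32 / 9) ^ (2 * σ) * ‖ξ‖ ^ (2 * σ) := by
      rw [← Real.mul_rpow (by norm_num) (norm_nonneg _)]
      refine Real.rpow_le_rpow (by positivity) ?_ (by positivity)
      linarith [hφ.le_norm h]
    have h2 : φ ((2 : ℝ) ^ (-j) • ξ) ^ 2 ≤ φ ((2 : ℝ) ^ (-j) • ξ) :=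
      pow_le_of_le_one h0 (hφ.le_one _) two_ne_zero
    calc _ ≤ ((32 / 9) ^ (2 * σ) * ‖ξ‖ ^ (2 * σ)) *
          (φ ((2 : ℝ) ^ (-j) • ξ) * ‖𝓕 (cf b) ξ‖ ^ 2) := by
          rw [mul_pow]
          gcongr
      _ = _ := by ring
  have hsum (ξ : Ell n) : ∑ j ∈ F, (8 / 3 * (2 : ℝ) ^ j) ^ (2 * σ) *
      ‖((φ ((2 : ℝ) ^ (-j) • ξ) : ℝ) : ℂ) * 𝓕 (cf b) ξ‖ ^ 2 ≤
      (32 / 9) ^ (2 * σ) * (‖ξ‖ ^ (2 * σ) * ‖𝓕 (cf b) ξ‖ ^ 2) := by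
    refine (Finset.sum_le_sum fun j _ => hpt j ξ).trans ?_
    rw [← Finset.sum_mul]
    refine mul_le_of_le_one_left (by positivity) ?_
    exact ((hφ.summable ξ).sum_le_tsum F fun j _ => hφ.nonneg _).trans (hφ.tsum_le_one ξ)
  have hcont (j : ℤ) : Continuous fun ξ => (8 / 3 * (2 : ℝ) ^ j) ^ (2 * σ) *
      ‖((φ ((2 : ℝ) ^ (-j) • ξ) : ℝ) : ℂ) * 𝓕 (cf b) ξ‖ ^ 2 := by
    have h1 := hφ.1.continuous
    rw [fourier_cf]
    have h2 := (𝓕 (complexify b) : 𝓢(Ell n, ℂ)).continuous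
    fun_prop
  have hjint (j : ℤ) : Integrable fun ξ => (8 / 3 * (2 : ℝ) ^ j) ^ (2 * σ) *
      ‖((φ ((2 : ℝ) ^ (-j) • ξ) : ℝ) : ℂ) * 𝓕 (cf b) ξ‖ ^ 2 := by
    refine (hb.const_mul ((32 / 9) ^ (2 * σ))).mono' (hcont j).aestronglyMeasurable
      (ae_of_all _ fun ξ => ?_)
    rw [Real.norm_of_nonneg (by positivity)]
    exact (hpt j ξ).trans (mul_le_of_le_one_left (by positivity) (hφ.le_one _))
  simp_rw [← integral_const_mul]
  rw [← integral_finsetSum _ fun j _ => hjint j, HsqC, ← integral_const_mul]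
  exact integral_mono (integrable_finsetSum _ fun j _ => hjint j) (hb.const_mul _) hsum

end DyadicEstimates

/-- **Low–high commutator piece.** Under the conditions `s ≥ 1`,
`1 ≤ s₁ < n/2 + 1`, `s₂ > 0`, `s₁ + s₂ = s + n/2 + 1`, one has
`Σ_j ‖Λ^s[((Ṡ_{j−9}u)·∇)Δ_j B] − ((Ṡ_{j−9}u)·∇)(Λ^s Δ_j B)‖²_{L²}
≤ c ‖u‖²_{Ḣ^{s₁}} ‖B‖²_{Ḣ^{s₂}}`. -/
theorem commutator_piece_lowhigh (n : ℕ) (hn : 1 ≤ n)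
    (φ : Ell n → ℝ) (hφ : LPFunction φ) (s s₁ s₂ : ℝ)
    (hs : 1 ≤ s) (hs₂ : 0 < s₂) (hs₁ : 1 ≤ s₁) (hs₁' : s₁ < (n : ℝ) / 2 + 1)
    (hsum : s₁ + s₂ = s + (n : ℝ) / 2 + 1) :
    ∃ c > (0 : ℝ), ∀ u B : Fin n → 𝓢(Ell n, ℝ),
      (∑' j : ℤ, ∑ l, ∫ x, ‖Lam s (adv (fun i => SJ φ (j - 9) (cf (u i)))
            (fun l' => DeltaJ φ j (cf (B l'))) l) x
          - adv (fun i => SJ φ (j - 9) (cf (u i)))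
            (fun l' => Lam s (DeltaJ φ j (cf (B l')))) l x‖ ^ 2)
        ≤ c * Hnorm s₁ (fun l x => u l x) ^ 2 * Hnorm s₂ (fun l x => B l x) ^ 2 := by
  have hd : 0 < (n : ℝ) + 2 - 2 * s₁ := by linarith
  set K : ℝ := n ^ 2 * (n * volume.real (Metric.ball (0 : Ell n) 1) / (n + 2 - 2 * s₁))
    * (Real.pi * s * 2 ^ s) ^ 2
  have hK : 0 ≤ K := by positivity
  refine ⟨K * (32 / 9) ^ (2 * s₂) + 1, by positivity, fun u B => ?_⟩
  refine Real.tsum_le_of_sum_le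
    (fun j => Finset.sum_nonneg fun l _ => integral_nonneg fun x => by positivity) fun F => ?_
  have hU : 0 ≤ K * Hnorm s₁ (fun l x => u l x) ^ 2 := by positivity
  refine (Finset.sum_le_sum fun j _ => Finset.sum_le_sum fun l _ =>
    hφ.integral_norm_sq_commutator_le hn hs (by linarith) hs₁' hsum u (B l) j).trans ?_
  rw [Finset.sum_comm]
  simp_rw [← Finset.mul_sum]
  calc _ ≤ K * Hnorm s₁ (fun l x => u l x) ^ 2
        * ∑ l, (32 / 9) ^ (2 * s₂) * HsqC s₂ (cf (B l)) :=
        mul_le_mul_of_nonneg_left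
          (Finset.sum_le_sum fun l _ => hφ.sum_rpow_mul_integral_le hs₂.le (B l) F) hU
    _ = K * (32 / 9) ^ (2 * s₂) * Hnorm s₁ (fun l x => u l x) ^ 2
        * Hnorm s₂ (fun l x => B l x) ^ 2 := by
        rw [← Finset.mul_sum, Hnorm_sq s₂]
        ring
    _ ≤ _ := by
        gcongr
        linarith

end
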